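/- Let Δ ∈ (1/2, 1) be real, set Δ̄ = 1 − Δ and N_Δ = Γ(Δ̄) / ( 2^Δ √π · Γ(Δ − 1/2) ). Then for every integer n ∈ ℤ and every x ∈ ℝ, the integral ∫_ℝ ( 2^{Δ̄} N_Δ / |x − y|^{2Δ̄} ) · ψ_n^{(Δ)}(y) dy converges absolutely and equals ( Γ(Δ̄ + n) / Γ(Δ + n) ) · ψ_n^{(Δ̄)}(x). -/

import Mathlib

open Complex MeasureTheory

/-- The basis wavefunction `ψ_n^{(Δ)}(x) = (2π)^{-1/2} ((1-ix)/(1+ix))^n 2^Δ (1+x²)^{-Δ}`,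
with complex powers on the principal branch. -/
noncomputable def psi (Δ : ℂ) (n : ℤ) (x : ℝ) : ℂ :=
  ((Real.sqrt (2 * Real.pi) : ℂ))⁻¹ * ((1 - Complex.I * x) / (1 + Complex.I * x)) ^ n
    * (2 : ℂ) ^ Δ * ((1 : ℂ) + (x : ℂ) ^ 2) ^ (-Δ)

/-- Complementary-series normalization constant
`N_Δ = Γ(Δ̄)/(2^Δ √π Γ(Δ − 1/2))` (with `Δ̄ = 1 − Δ`). -/
noncomputable def NDelta (Δ : ℝ) : ℝ :=
  Real.Gamma (1 - Δ) / ((2 : ℝ) ^ Δ * Real.sqrt Real.pi * Real.Gamma (Δ - 1/2))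

open Filter Topology Set

theorem integrable_one_add_sq_rpow_neg {a : ℝ} (ha : 1 / 2 < a) :
    Integrable fun t : ℝ => (1 + t ^ 2) ^ (-a) := by
  have h := integrable_rpow_neg_one_add_norm_sq (E := ℝ) (μ := volume) (r := 2 * a)
    (by simp; linarith)
  refine h.congr (ae_of_all _ fun t => ?_)
  simp only [Real.norm_eq_abs, sq_abs]
  congr 1
  ring

theorem integral_one_add_sq_rpow_neg {a : ℝ} (ha : 1 / 2 < a) :
    ∫ t : ℝ, (1 + t ^ 2) ^ (-a) = √Real.pi * Real.Gamma (a - 1 / 2) / Real.Gamma a := by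
  have ha0 : 0 < a := by linarith
  have hpos (t : ℝ) : 0 < 1 + t ^ 2 := by positivity
  let f : ℝ → ℝ → ℝ := fun t s => s ^ (a - 1) * Real.exp (-((1 + t ^ 2) * s))
  have hinner (t : ℝ) : ∫ s in Ioi 0, f t s = (1 + t ^ 2) ^ (-a) * Real.Gamma a := by
    rw [Real.integral_rpow_mul_exp_neg_mul_Ioi ha0 (hpos t), one_div,
      Real.inv_rpow (hpos t).le, Real.rpow_neg (hpos t).le]
  have hfint : Integrable (Function.uncurry f) (volume.prod (volume.restrict (Ioi 0))) := by
    rw [integrable_prod_iff (by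
      apply Measurable.aestronglyMeasurable
      simp only [f, Function.uncurry_def]
      fun_prop)]
    refine ⟨ae_of_all _ fun t => ?_, ?_⟩
    · refine Integrable.of_integral_ne_zero ?_
      change ∫ s in Ioi 0, f t s ≠ 0
      rw [hinner]
      have := Real.Gamma_pos_of_pos ha0
      have := hpos t
      positivity
    · refine ((integrable_one_add_sq_rpow_neg ha).mul_const (Real.Gamma a)).congr
        (ae_of_all _ fun t => ?_)
      simp only
      rw [← hinner]
      refine setIntegral_congr_fun measurableSet_Ioi fun s (hs : 0 < s) => ?_
      simp only [Function.uncurry, f]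
      rw [Real.norm_of_nonneg (by positivity)]
  have hswap := integral_integral_swap hfint
  simp only [hinner, integral_mul_const] at hswap
  rw [eq_div_iff (Real.Gamma_pos_of_pos ha0).ne', hswap]
  have hs1 : ∀ s ∈ Ioi (0 : ℝ), ∫ t, f t s
      = √Real.pi * (s ^ ((a - 1 / 2) - 1) * Real.exp (-(1 * s))) := by
    intro s (hs : 0 < s)
    have hg : ∀ t, f t s = s ^ (a - 1) * Real.exp (-s) * Real.exp (-s * t ^ 2) := by
      intro t
      simp only [f]
      rw [mul_assoc, ← Real.exp_add]
      ring_nf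
    simp only [hg]
    rw [integral_const_mul, integral_gaussian, Real.sqrt_div Real.pi_pos.le,
      show a - 1 / 2 - 1 = (a - 1) - 1 / 2 by ring, Real.rpow_sub hs (a - 1), ← Real.sqrt_eq_rpow, one_mul]
    ring
  rw [setIntegral_congr_fun measurableSet_Ioi hs1, integral_const_mul,
    Real.integral_rpow_mul_exp_neg_mul_Ioi (by linarith) one_pos]
  simp

/-- The Cayley phase `(t + i) / (t - i)`. -/
noncomputable def cayleyPhase (t : ℝ) : ℂ := (t + I) / (t - I)

theorem ofReal_add_I_ne_zero (t : ℝ) : (t : ℂ) + I ≠ 0 := by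
  intro h; simpa using congrArg im h

theorem ofReal_sub_I_ne_zero (t : ℝ) : (t : ℂ) - I ≠ 0 := by
  intro h; simpa using congrArg im h

theorem cayleyPhase_ne_zero (t : ℝ) : cayleyPhase t ≠ 0 :=
  div_ne_zero (ofReal_add_I_ne_zero t) (ofReal_sub_I_ne_zero t)

theorem norm_ofReal_add_I_sq (t : ℝ) : ‖(t : ℂ) + I‖ ^ 2 = 1 + t ^ 2 := by
  rw [← normSq_eq_norm_sq, normSq_apply]; simp; ring

theorem norm_cayleyPhase (t : ℝ) : ‖cayleyPhase t‖ = 1 := by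
  have h : ‖(t : ℂ) - I‖ = ‖(t : ℂ) + I‖ := by
    rw [← Complex.norm_conj]; simp
  rw [cayleyPhase, norm_div, h, div_self (norm_ne_zero_iff.2 (ofReal_add_I_ne_zero t))]

theorem hasDerivAt_cayleyPhase (t : ℝ) :
    HasDerivAt cayleyPhase (-(2 * I) / ((t : ℂ) - I) ^ 2) t := by
  have h1 := ((hasDerivAt_id t).ofReal_comp.add_const I).div
    ((hasDerivAt_id t).ofReal_comp.sub_const I) (ofReal_sub_I_ne_zero t)
  refine h1.congr_deriv ?_
  simp
  ring

theorem continuous_cayleyPhase : Continuous cayleyPhase :=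
  continuous_iff_continuousAt.2 fun t => (hasDerivAt_cayleyPhase t).continuousAt

theorem integrable_cayleyPhase_zpow_mul {a : ℝ} (ha : 1 / 2 < a) (n : ℤ) :
    Integrable fun t : ℝ => cayleyPhase t ^ n * (((1 + t ^ 2) ^ (-a) : ℝ) : ℂ) := by
  refine (integrable_one_add_sq_rpow_neg ha).ofReal.bdd_mul (c := 1) ?_ (ae_of_all _ fun t => ?_)
  · exact (continuous_cayleyPhase.zpow₀ n
      fun t => Or.inl (cayleyPhase_ne_zero t)).aestronglyMeasurable
  · rw [norm_zpow, norm_cayleyPhase, one_zpow]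

theorem hasDerivAt_cayleyPhase_primitive (a : ℝ) (n : ℤ) (t : ℝ) :
    HasDerivAt (fun t : ℝ => ((t : ℂ) + I) * (cayleyPhase t ^ n * (((1 + t ^ 2) ^ (-a) : ℝ) : ℂ)))
      ((1 - a + n) * (cayleyPhase t ^ n * (((1 + t ^ 2) ^ (-a) : ℝ) : ℂ))
        - (a + n) * (cayleyPhase t ^ (n + 1) * (((1 + t ^ 2) ^ (-a) : ℝ) : ℂ))) t := by
  have hpos : 0 < 1 + t ^ 2 := by positivity
  have h1 := (hasDerivAt_id t).ofReal_comp.add_const I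
  have h2 : HasDerivAt (fun t => cayleyPhase t ^ n) _ t :=
    (hasDerivAt_zpow n (cayleyPhase t) (Or.inl (cayleyPhase_ne_zero t))).comp t
      (hasDerivAt_cayleyPhase t)
  have h3 := ((((hasDerivAt_id t).pow 2).const_add 1).rpow_const (p := -a)
    (Or.inl hpos.ne')).ofReal_comp
  refine (h1.mul (h2.mul h3)).congr_deriv ?_
  simp only [Pi.mul_apply, Pi.pow_apply, id, Real.rpow_sub_one hpos.ne',
    zpow_add_one₀ (cayleyPhase_ne_zero t), zpow_sub_one₀ (cayleyPhase_ne_zero t)]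
  generalize (1 + t ^ 2) ^ (-a) = r
  have hfac : (1 : ℂ) + (t : ℂ) ^ 2 = (t + I) * (t - I) := by
    ring_nf; simp; ring
  have hp := ofReal_add_I_ne_zero t
  have hm := ofReal_sub_I_ne_zero t
  generalize hz : cayleyPhase t ^ n = z
  push_cast
  rw [hfac, cayleyPhase]
  field_simp
  ring

theorem tendsto_cayleyPhase_primitive {a : ℝ} (ha : 1 / 2 < a) (n : ℤ) {l : Filter ℝ}
    (hl : Tendsto (fun t : ℝ => |t|) l atTop) :
    Tendsto (fun t : ℝ => ((t : ℂ) + I) * (cayleyPhase t ^ n * (((1 + t ^ 2) ^ (-a) : ℝ) : ℂ)))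
      l (𝓝 0) := by
  rw [tendsto_zero_iff_norm_tendsto_zero]
  have hnorm : ∀ t : ℝ, ‖((t : ℂ) + I) * (cayleyPhase t ^ n * (((1 + t ^ 2) ^ (-a) : ℝ) : ℂ))‖
      = (1 + t ^ 2) ^ (-(a - 1 / 2)) := by
    intro t
    have hpos : 0 < 1 + t ^ 2 := by positivity
    have h : ‖(t : ℂ) + I‖ = (1 + t ^ 2) ^ (1 / 2 : ℝ) := by
      rw [← norm_ofReal_add_I_sq, ← Real.sqrt_eq_rpow, Real.sqrt_sq (norm_nonneg _)]
    rw [norm_mul, norm_mul, norm_zpow, norm_cayleyPhase, one_zpow, one_mul, h,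
      Complex.norm_of_nonneg (by positivity), ← Real.rpow_add hpos]
    ring_nf
  simp only [hnorm]
  refine (tendsto_rpow_neg_atTop (by linarith)).comp (tendsto_atTop_add_const_left _ _ ?_)
  simpa [Function.comp_def] using (tendsto_pow_atTop (two_ne_zero (α := ℕ))).comp hl

theorem integral_cayleyPhase_succ {a : ℝ} (ha : 1 / 2 < a) (n : ℤ) :
    (a + n) * ∫ t : ℝ, cayleyPhase t ^ (n + 1) * (((1 + t ^ 2) ^ (-a) : ℝ) : ℂ)
      = (1 - a + n) * ∫ t : ℝ, cayleyPhase t ^ n * (((1 + t ^ 2) ^ (-a) : ℝ) : ℂ) := by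
  have h1 := (integrable_cayleyPhase_zpow_mul ha n).const_mul (1 - a + n : ℂ)
  have h2 := (integrable_cayleyPhase_zpow_mul ha (n + 1)).const_mul (a + n : ℂ)
  have h := integral_of_hasDerivAt_of_tendsto (hasDerivAt_cayleyPhase_primitive a n) (h1.sub h2)
    (tendsto_cayleyPhase_primitive ha n tendsto_abs_atBot_atTop)
    (tendsto_cayleyPhase_primitive ha n tendsto_abs_atTop_atTop)
  rw [integral_sub h1 h2, integral_const_mul, integral_const_mul, sub_zero] at h
  exact (sub_eq_zero.1 h).symm

theorem Real.add_intCast_ne_zero_of_mem_Ioo {a : ℝ} (ha : a ∈ Ioo (0 : ℝ) 1) (n : ℤ) :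
    a + n ≠ 0 := by
  intro h
  have h1 : (-1 : ℝ) < n := by linarith [ha.2]
  have h2 : (n : ℝ) < 0 := by linarith [ha.1]
  have h3 : (-1 : ℤ) < n := by exact_mod_cast h1
  have h4 : n < 0 := by exact_mod_cast h2
  omega

theorem integral_cayleyPhase_zpow {a : ℝ} (ha : a ∈ Ioo (1 / 2 : ℝ) 1) (n : ℤ) :
    ∫ t : ℝ, cayleyPhase t ^ n * (((1 + t ^ 2) ^ (-a) : ℝ) : ℂ)
      = ((√Real.pi * Real.Gamma (a - 1 / 2) / Real.Gamma (1 - a)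
          * (Real.Gamma (1 - a + n) / Real.Gamma (a + n)) : ℝ) : ℂ) := by
  have ha' : a ∈ Ioo (0 : ℝ) 1 := ⟨by linarith [ha.1], ha.2⟩
  have hb' : 1 - a ∈ Ioo (0 : ℝ) 1 := ⟨by linarith [ha.2], by linarith [ha'.1]⟩
  have hstep (k : ℤ) : (a + k) * (Real.Gamma (1 - a + (k + 1 : ℤ)) / Real.Gamma (a + (k + 1 : ℤ)))
      = (1 - a + k) * (Real.Gamma (1 - a + k) / Real.Gamma (a + k)) := by
    have h1 := Real.add_intCast_ne_zero_of_mem_Ioo ha' k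
    push_cast
    rw [← add_assoc, ← add_assoc, Real.Gamma_add_one h1,
      Real.Gamma_add_one (Real.add_intCast_ne_zero_of_mem_Ioo hb' k)]
    rw [← mul_div_assoc, mul_div_mul_left _ _ h1, mul_div_assoc]
  have hstepC (k : ℤ) := congrArg (ofReal) (hstep k)
  induction n using Int.induction_on with
  | zero =>
    have hG := (Real.Gamma_pos_of_pos hb'.1).ne'
    simp only [zpow_zero, one_mul, Int.cast_zero, add_zero]
    rw [integral_complex_ofReal, integral_one_add_sq_rpow_neg ha.1]
    congr 1
    field_simp
  | succ k ih =>
    have h1 := ofReal_ne_zero.2 (Real.add_intCast_ne_zero_of_mem_Ioo ha' k)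
    have h2 := integral_cayleyPhase_succ ha.1 k
    have h3 := hstepC k
    rw [ih] at h2
    push_cast at h1 h2 h3 ⊢
    apply mul_left_cancel₀ h1
    rw [h2]
    linear_combination -(√Real.pi * Real.Gamma (a - 1 / 2) / Real.Gamma (1 - a) : ℂ) * h3
  | pred k ih =>
    have h1 := ofReal_ne_zero.2 (Real.add_intCast_ne_zero_of_mem_Ioo hb' (-k - 1))
    have h2 := integral_cayleyPhase_succ ha.1 (-k - 1)
    have h3 := hstepC (-k - 1)
    rw [sub_add_cancel] at h2 h3
    rw [ih] at h2
    push_cast at h1 h2 h3 ⊢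
    apply mul_left_cancel₀ h1
    rw [← h2]
    linear_combination (√Real.pi * Real.Gamma (a - 1 / 2) / Real.Gamma (1 - a) : ℂ) * h3

theorem psi_ofReal (a : ℝ) (n : ℤ) (x : ℝ) :
    psi (a : ℂ) n x = (((√(2 * Real.pi))⁻¹ * 2 ^ a * (1 + x ^ 2) ^ (-a) : ℝ) : ℂ)
      * ((1 - I * x) / (1 + I * x)) ^ n := by
  have hx : 0 ≤ 1 + x ^ 2 := by positivity
  rw [psi]
  push_cast [ofReal_cpow hx, ofReal_cpow (zero_le_two (α := ℝ))]
  ring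

theorem one_add_I_mul_ofReal_ne_zero (x : ℝ) : (1 : ℂ) + I * x ≠ 0 := by
  intro h; simpa using congrArg re h

/-- The fractional linear map `t ↦ (x t - 1) / (t + x)` acts on the phase by multiplication. -/
theorem phase_sub_div {x t : ℝ} (ht : t + x ≠ 0) :
    (1 - I * ((x - (1 + x ^ 2) / (t + x) : ℝ) : ℂ))
        / (1 + I * ((x - (1 + x ^ 2) / (t + x) : ℝ) : ℂ))
      = (1 - I * x) / (1 + I * x) * cayleyPhase t := by
  have h0 : (t : ℂ) + x ≠ 0 := by exact_mod_cast ht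
  have h1 := one_add_I_mul_ofReal_ne_zero (x - (1 + x ^ 2) / (t + x))
  have h2 := one_add_I_mul_ofReal_ne_zero x
  have h3 := ofReal_sub_I_ne_zero t
  have e1 : (1 : ℂ) + I * ((x - (1 + x ^ 2) / (t + x) : ℝ) : ℂ)
      = (1 + I * x) * (t - I) / (t + x) := by
    push_cast
    field_simp
    ring_nf
    simp only [I_sq]
    ring
  have e2 : (1 : ℂ) - I * ((x - (1 + x ^ 2) / (t + x) : ℝ) : ℂ)
      = (1 - I * x) * (t + I) / (t + x) := by
    push_cast
    field_simp
    ring_nf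
    simp only [I_sq]
    ring
  rw [e1, e2, cayleyPhase, div_div_div_cancel_right₀ h0, mul_div_mul_comm]

theorem one_add_sub_div_sq {x t : ℝ} (ht : t + x ≠ 0) :
    1 + (x - (1 + x ^ 2) / (t + x)) ^ 2 = (1 + x ^ 2) * (1 + t ^ 2) / |t + x| ^ 2 := by
  rw [sq_abs]
  field_simp
  ring

theorem rpow_jacobian_identity (a : ℝ) {q u p : ℝ} (hq : 0 < q) (hu : 0 < u) (hp : 0 < p) :
    q / u ^ 2 * (((q / u) ^ (2 * (1 - a)))⁻¹ * (q * p / u ^ 2) ^ (-a))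
      = q ^ (-(1 - a)) * p ^ (-a) := by
  rw [← Real.exp_log hq, ← Real.exp_log hu, ← Real.exp_log hp]
  simp only [← Real.exp_nat_mul, ← Real.exp_sub, ← Real.exp_mul, ← Real.exp_add, ← Real.exp_neg]
  congr 1
  push_cast
  ring

theorem image_sub_div_compl {x c : ℝ} (hc : c ≠ 0) :
    (fun t : ℝ => x - c / (t + x)) '' {-x}ᶜ = {x}ᶜ := by
  ext y
  simp only [mem_image, mem_compl_iff, mem_singleton_iff]
  constructor
  · rintro ⟨t, ht, rfl⟩ h
    have h0 : t + x ≠ 0 := fun h => ht (by linarith)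
    exact div_ne_zero hc h0 (by linarith)
  · intro hy
    have h0 : x - y ≠ 0 := fun h => hy (by linarith)
    refine ⟨c / (x - y) - x, fun h => div_ne_zero hc h0 (by linarith), ?_⟩
    rw [sub_add_cancel, div_div_cancel₀ hc]
    ring

theorem injOn_sub_div {x c : ℝ} (hc : c ≠ 0) :
    InjOn (fun t : ℝ => x - c / (t + x)) {-x}ᶜ := by
  intro s hs t ht h
  have hs0 : s + x ≠ 0 := fun h => hs (by simp; linarith)
  have ht0 : t + x ≠ 0 := fun h => ht (by simp; linarith)
  have h' : c / (s + x) = c / (t + x) := by simpa using h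
  rw [div_eq_div_iff hs0 ht0] at h'
  linarith [mul_left_cancel₀ hc h']

theorem hasDerivAt_sub_div {x c t : ℝ} (ht : t + x ≠ 0) :
    HasDerivAt (fun t : ℝ => x - c / (t + x)) (c / (t + x) ^ 2) t := by
  have h := (((hasDerivAt_id t).add_const x).fun_inv ht).const_mul c |>.const_sub x
  refine (h.congr_deriv ?_)
  simp
  ring

theorem shadow_integrand_comp (a C : ℝ) (n : ℤ) {x t : ℝ} (ht : t ∈ ({-x}ᶜ : Set ℝ)) :
    |(1 + x ^ 2) / (t + x) ^ 2| •
        (((C / |x - (x - (1 + x ^ 2) / (t + x))| ^ (2 * (1 - a)) : ℝ) : ℂ)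
          * psi (a : ℂ) n (x - (1 + x ^ 2) / (t + x)))
      = ((C * (√(2 * Real.pi))⁻¹ * 2 ^ a * (1 + x ^ 2) ^ (-(1 - a)) : ℝ) : ℂ)
          * ((1 - I * x) / (1 + I * x)) ^ n
        * (cayleyPhase t ^ n * (((1 + t ^ 2) ^ (-a) : ℝ) : ℂ)) := by
  have h0 : t + x ≠ 0 := fun h => ht (by simp; linarith)
  have hq : 0 < 1 + x ^ 2 := by positivity
  have key := congrArg ofReal
    (rpow_jacobian_identity a hq (abs_pos.2 h0) (show 0 < 1 + t ^ 2 by positivity))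
  rw [psi_ofReal, phase_sub_div h0, one_add_sub_div_sq h0, sub_sub_cancel, abs_div, abs_div,
    abs_of_pos hq, abs_pow, mul_zpow, real_smul, div_eq_mul_inv C]
  simp only [ofReal_mul] at key ⊢
  linear_combination (C * ((√(2 * Real.pi))⁻¹ : ℝ) * ((2 ^ a : ℝ) : ℂ)
    * ((1 - I * x) / (1 + I * x)) ^ n * cayleyPhase t ^ n) * key

/-- The shadow transformation with kernel `S_Δ(x,y) = 2^{Δ̄} N_Δ |x−y|^{−2Δ̄}` maps
`ψ_n^{(Δ)}` to `(Γ(Δ̄+n)/Γ(Δ+n)) ψ_n^{(Δ̄)}`, where `Δ̄ = 1 − Δ`. -/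
theorem stmt8 (Δ : ℝ) (hΔ : Δ ∈ Set.Ioo (1/2 : ℝ) 1) (n : ℤ) (x : ℝ) :
    Integrable (fun y : ℝ =>
      (((2 : ℝ) ^ (1 - Δ) * NDelta Δ / |x - y| ^ (2 * (1 - Δ)) : ℝ) : ℂ)
        * psi (Δ : ℂ) n y) ∧
    (∫ y : ℝ,
      (((2 : ℝ) ^ (1 - Δ) * NDelta Δ / |x - y| ^ (2 * (1 - Δ)) : ℝ) : ℂ)
        * psi (Δ : ℂ) n y)
      = ((Real.Gamma ((1 - Δ) + n) / Real.Gamma (Δ + n) : ℝ) : ℂ)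
          * psi ((1 - Δ : ℝ) : ℂ) n x := by
  set C : ℝ := 2 ^ (1 - Δ) * NDelta Δ with hC
  have hq : 1 + x ^ 2 ≠ 0 := by positivity
  have hderiv : ∀ t ∈ ({-x}ᶜ : Set ℝ), HasDerivWithinAt
      (fun t : ℝ => x - (1 + x ^ 2) / (t + x)) ((1 + x ^ 2) / (t + x) ^ 2) {-x}ᶜ t :=
    fun t ht => (hasDerivAt_sub_div fun h => ht (by simp; linarith)).hasDerivWithinAt
  have hms (z : ℝ) : MeasurableSet ({z}ᶜ : Set ℝ) := (measurableSet_singleton z).compl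
  have hcompl (z : ℝ) : volume.restrict ({z}ᶜ : Set ℝ) = volume :=
    Measure.restrict_eq_self_of_ae_mem (by simp [ae_iff])
  constructor
  · have h := integrableOn_image_iff_integrableOn_abs_deriv_smul (hms _) hderiv (injOn_sub_div hq)
      (fun y => ((C / |x - y| ^ (2 * (1 - Δ)) : ℝ) : ℂ) * psi (Δ : ℂ) n y)
    rw [image_sub_div_compl hq, integrableOn_congr_fun
      (fun t ht => shadow_integrand_comp Δ C n ht) (hms _)] at h
    simp only [IntegrableOn, hcompl] at h
    exact h.2 ((integrable_cayleyPhase_zpow_mul hΔ.1 n).const_mul _)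
  · have h := integral_image_eq_integral_abs_deriv_smul (hms _) hderiv (injOn_sub_div hq)
      (fun y => ((C / |x - y| ^ (2 * (1 - Δ)) : ℝ) : ℂ) * psi (Δ : ℂ) n y)
    rw [image_sub_div_compl hq, setIntegral_congr_fun (hms _)
      (fun t ht => shadow_integrand_comp Δ C n ht)] at h
    simp only [hcompl] at h
    have hG1 := (Real.Gamma_pos_of_pos (show 0 < 1 - Δ by linarith [hΔ.2])).ne'
    have hG2 := (Real.Gamma_pos_of_pos (show 0 < Δ - 1 / 2 by linarith [hΔ.1])).ne'
    have hpi : √Real.pi ≠ 0 := by positivity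
    have h2 : (2 : ℝ) ^ Δ ≠ 0 := by positivity
    have hreal : C * (√(2 * Real.pi))⁻¹ * 2 ^ Δ * (1 + x ^ 2) ^ (-(1 - Δ))
        * (√Real.pi * Real.Gamma (Δ - 1 / 2) / Real.Gamma (1 - Δ)
          * (Real.Gamma (1 - Δ + n) / Real.Gamma (Δ + n)))
        = Real.Gamma (1 - Δ + n) / Real.Gamma (Δ + n)
          * ((√(2 * Real.pi))⁻¹ * 2 ^ (1 - Δ) * (1 + x ^ 2) ^ (-(1 - Δ))) := by
      generalize Real.Gamma (1 - Δ + n) / Real.Gamma (Δ + n) = r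
      rw [hC, NDelta]
      generalize Real.Gamma (Δ - 1 / 2) = g at hG2 ⊢
      field_simp
    rw [h, integral_const_mul, integral_cayleyPhase_zpow hΔ, psi_ofReal, ← mul_assoc, ← ofReal_mul,
      ← hreal]
    push_cast
    ring
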